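/- Let m, ω, ħ > 0 and let f₂ : ℂ → ℂ be entire. Then the function f(t,x₁,x₃) = exp(−iωt/2 + πiħ x₁x₃ − (πħ/(2mω))(m²ω²x₁² + x₃²)) · f₂(e^{−iωt}(x₃ − imω x₁)) satisfies the harmonic oscillator Schrödinger equation iħ ∂ₜf = −(1/(4πm)) ∂₁₁f − (mω²/(4π)) ∂₃₃f + (iħ/m) x₃ ∂₁f + (πħ²/m) x₃² f for all (t,x₁,x₃) ∈ ℝ³. -/

import Mathlib

/-- Partial derivative in the first variable (t) of a function on ℝ³. -/
noncomputable def pdt (F : ℝ × ℝ × ℝ → ℂ) : ℝ × ℝ × ℝ → ℂ :=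
  fun p => deriv (fun s => F (s, p.2.1, p.2.2)) p.1

/-- Partial derivative in the second variable (x₁) of a function on ℝ³. -/
noncomputable def pd1 (F : ℝ × ℝ × ℝ → ℂ) : ℝ × ℝ × ℝ → ℂ :=
  fun p => deriv (fun s => F (p.1, s, p.2.2)) p.2.1

/-- Partial derivative in the third variable (x₃) of a function on ℝ³. -/
noncomputable def pd3 (F : ℝ × ℝ × ℝ → ℂ) : ℝ × ℝ × ℝ → ℂ :=
  fun p => deriv (fun s => F (p.1, p.2.1, s)) p.2.2

theorem aux_poly (a b c : ℂ) (x : ℝ) :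
    HasDerivAt (fun s : ℝ => a + b * (s : ℂ) + c * (s : ℂ) ^ 2) (b + 2 * c * x) x := by
  have h1 : HasDerivAt (fun s : ℝ => (s : ℂ)) 1 x := Complex.ofRealCLM.hasDerivAt
  have h2 := ((h1.const_mul b).const_add a).add ((h1.pow 2).const_mul c)
  refine h2.congr_deriv ?_
  push_cast
  ring

theorem aux_lin (u v : ℂ) (x : ℝ) :
    HasDerivAt (fun s : ℝ => u + v * (s : ℂ)) v x := by
  have h1 : HasDerivAt (fun s : ℝ => (s : ℂ)) 1 x := Complex.ofRealCLM.hasDerivAt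
  refine ((h1.const_mul v).const_add u).congr_deriv ?_
  ring

theorem aux_key {E W : ℝ → ℂ} {E' W' : ℂ} {x : ℝ} {g : ℂ → ℂ} (hE : HasDerivAt E E' x)
    (hW : HasDerivAt W W' x) (hg : Differentiable ℂ g) :
    HasDerivAt (fun s => Complex.exp (E s) * g (W s))
      (Complex.exp (E x) * (E' * g (W x) + W' * deriv g (W x))) x := by
  have h := hE.cexp.mul ((hg (W x)).hasDerivAt.comp x hW)
  refine h.congr_deriv ?_
  simp only [Function.comp]
  ring

/-- first and second derivative of a Gaussian times an entire function of a linear form -/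
theorem aux_d1 (a b c u v : ℂ) {g : ℂ → ℂ} (hg : Differentiable ℂ g) (x : ℝ) :
    HasDerivAt (fun s : ℝ => Complex.exp (a + b * (s : ℂ) + c * (s : ℂ) ^ 2) * g (u + v * s))
      (Complex.exp (a + b * (x : ℂ) + c * (x : ℂ) ^ 2) *
        ((b + 2 * c * x) * g (u + v * x) + v * deriv g (u + v * x))) x :=
  aux_key (aux_poly a b c x) (aux_lin u v x) hg

theorem aux_d2 (a b c u v : ℂ) {g : ℂ → ℂ} (hg : Differentiable ℂ g) (x : ℝ) :
    HasDerivAt (fun x : ℝ => Complex.exp (a + b * (x : ℂ) + c * (x : ℂ) ^ 2) *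
        ((b + 2 * c * x) * g (u + v * x) + v * deriv g (u + v * x)))
      (Complex.exp (a + b * (x : ℂ) + c * (x : ℂ) ^ 2) *
        (((b + 2 * c * x) ^ 2 + 2 * c) * g (u + v * x)
          + 2 * v * (b + 2 * c * x) * deriv g (u + v * x)
          + v ^ 2 * deriv (deriv g) (u + v * x))) x := by
  have hg' : Differentiable ℂ (deriv g) := by
    have h := hg.contDiff (n := 2)
    exact (h.differentiable_deriv_two)
  have h1 := ((aux_lin b (2 * c) x).mul (aux_d1 a b c u v hg x))
  have h2 := (aux_d1 a b c u v hg' x).const_mul v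
  have h3 := h1.add h2
  refine (h3.congr_deriv ?_).congr_of_eventuallyEq (Filter.Eventually.of_forall fun s => ?_)
  · ring
  · simp only [Pi.add_apply, Pi.mul_apply]
    ring

theorem stmt12 (m ω ℏ : ℝ) (hm : 0 < m) (hω : 0 < ω) (hℏ : 0 < ℏ)
    (f₂ : ℂ → ℂ) (hf₂ : Differentiable ℂ f₂)
    (f : ℝ × ℝ × ℝ → ℂ)
    (hf : f = fun p : ℝ × ℝ × ℝ =>
      Complex.exp (-(Complex.I * ω * p.1) / 2
          + Real.pi * Complex.I * ℏ * p.2.1 * p.2.2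
          - (Real.pi * ℏ / (2 * m * ω)) * (m^2 * ω^2 * p.2.1^2 + p.2.2^2)) *
        f₂ (Complex.exp (-(Complex.I * ω * p.1)) * (p.2.2 - Complex.I * m * ω * p.2.1))) :
    ∀ p : ℝ × ℝ × ℝ,
      Complex.I * ℏ * pdt f p
        = -(1 / (4 * Real.pi * m)) * pd1 (pd1 f) p
          - (m * ω^2 / (4 * Real.pi)) * pd3 (pd3 f) p
          + (Complex.I * ℏ / m) * p.2.2 * pd1 f p
          + (Real.pi * ℏ^2 / m) * p.2.2^2 * f p := by
  rintro ⟨t, x, y⟩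
  have hmC : (m : ℂ) ≠ 0 := by exact_mod_cast hm.ne'
  have hωC : (ω : ℂ) ≠ 0 := by exact_mod_cast hω.ne'
  have hπC : (Real.pi : ℂ) ≠ 0 := by exact_mod_cast Real.pi_ne_zero
  -- slices
  have s1 : ∀ t y : ℝ, (fun s : ℝ => f (t, s, y)) = fun s : ℝ =>
      Complex.exp ((-(Complex.I * ω * t) / 2 - (Real.pi * ℏ / (2 * m * ω)) * y ^ 2)
        + (Real.pi * Complex.I * ℏ * y) * (s : ℂ)
        + (-(Real.pi * ℏ / (2 * m * ω)) * (m ^ 2 * ω ^ 2)) * (s : ℂ) ^ 2) *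
      f₂ (Complex.exp (-(Complex.I * ω * t)) * y
        + (Complex.exp (-(Complex.I * ω * t)) * (-(Complex.I * m * ω))) * s) := by
    intro t y
    subst hf
    funext s
    dsimp only
    congr 2 <;> ring
  have s3 : ∀ t x : ℝ, (fun s : ℝ => f (t, x, s)) = fun s : ℝ =>
      Complex.exp ((-(Complex.I * ω * t) / 2
          - (Real.pi * ℏ / (2 * m * ω)) * (m ^ 2 * ω ^ 2 * x ^ 2))
        + (Real.pi * Complex.I * ℏ * x) * (s : ℂ)
        + (-(Real.pi * ℏ / (2 * m * ω))) * (s : ℂ) ^ 2) *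
      f₂ (Complex.exp (-(Complex.I * ω * t)) * (-(Complex.I * m * ω * x))
        + Complex.exp (-(Complex.I * ω * t)) * s) := by
    intro t x
    subst hf
    funext s
    dsimp only
    congr 2 <;> ring
  have d1 := fun s : ℝ => (show pd1 f (t, s, y) = deriv (fun s => f (t, s, y)) s from rfl).trans
    ((congrArg (fun F : ℝ → ℂ => deriv F s) (s1 t y)).trans (aux_d1 _ _ _ _ _ hf₂ s).deriv)
  have d3 := fun s : ℝ => (show pd3 f (t, x, s) = deriv (fun s => f (t, x, s)) s from rfl).trans
    ((congrArg (fun F : ℝ → ℂ => deriv F s) (s3 t x)).trans (aux_d1 _ _ _ _ _ hf₂ s).deriv)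
  have d11 := (show pd1 (pd1 f) (t, x, y) = deriv (fun s => pd1 f (t, s, y)) x from rfl).trans
    ((congrArg (fun F : ℝ → ℂ => deriv F x) (funext d1)).trans (aux_d2 _ _ _ _ _ hf₂ x).deriv)
  have d33 := (show pd3 (pd3 f) (t, x, y) = deriv (fun s => pd3 f (t, x, s)) y from rfl).trans
    ((congrArg (fun F : ℝ → ℂ => deriv F y) (funext d3)).trans (aux_d2 _ _ _ _ _ hf₂ y).deriv)
  set G : ℂ := Complex.exp (-(Complex.I * ω * t) / 2
          + Real.pi * Complex.I * ℏ * x * y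
          - (Real.pi * ℏ / (2 * m * ω)) * (m^2 * ω^2 * x^2 + y^2)) with hG
  set e : ℂ := Complex.exp (-(Complex.I * ω * t)) with he
  set z : ℂ := e * (y - Complex.I * m * ω * x) with hz
  have f0 : f (t, x, y) = G * f₂ z := by rw [hf]
  have dt : pdt f (t, x, y) = G * (-(Complex.I * ω) / 2 * f₂ z
      + (-(Complex.I * ω)) * z * deriv f₂ z) := by
    have hl : HasDerivAt (fun s : ℝ => -(Complex.I * ω * (s : ℂ))) (-(Complex.I * ω)) t := by
      refine (aux_lin 0 (-(Complex.I * ω)) t).congr_of_eventuallyEq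
        (Filter.Eventually.of_forall fun s => ?_)
      dsimp only
      ring
    have h := aux_key (((hl.div_const 2).add_const (Real.pi * Complex.I * ℏ * x * y : ℂ)).sub_const
      ((Real.pi * ℏ / (2 * m * ω)) * (m^2 * ω^2 * x^2 + y^2) : ℂ))
      (hl.cexp.mul_const (y - Complex.I * m * ω * x : ℂ)) hf₂
    unfold pdt
    rw [hf]
    refine h.deriv.trans ?_
    rw [hz, he, hG]
    ring
  have e1 : (-(Complex.I * ω * t) / 2 - (Real.pi * ℏ / (2 * m * ω)) * y ^ 2)
        + (Real.pi * Complex.I * ℏ * y) * (x : ℂ)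
        + (-(Real.pi * ℏ / (2 * m * ω)) * (m ^ 2 * ω ^ 2)) * (x : ℂ) ^ 2
      = -(Complex.I * ω * t) / 2 + Real.pi * Complex.I * ℏ * x * y
          - (Real.pi * ℏ / (2 * m * ω)) * (m^2 * ω^2 * x^2 + y^2) := by ring
  have e3 : (-(Complex.I * ω * t) / 2
          - (Real.pi * ℏ / (2 * m * ω)) * (m ^ 2 * ω ^ 2 * x ^ 2))
        + (Real.pi * Complex.I * ℏ * x) * (y : ℂ)
        + (-(Real.pi * ℏ / (2 * m * ω))) * (y : ℂ) ^ 2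
      = -(Complex.I * ω * t) / 2 + Real.pi * Complex.I * ℏ * x * y
          - (Real.pi * ℏ / (2 * m * ω)) * (m^2 * ω^2 * x^2 + y^2) := by ring
  have z1 : e * y + (e * (-(Complex.I * m * ω))) * x = z := by rw [hz]; ring
  have z3 : e * (-(Complex.I * m * ω * x)) + e * y = z := by rw [hz]; ring
  have d1x := d1 x
  rw [e1, z1, ← hG] at d1x d11
  rw [e3, z3, ← hG] at d33
  rw [dt, d11, d33, d1x, f0]
  dsimp only
  clear_value G
  generalize f₂ z = A
  generalize deriv f₂ z = B
  generalize deriv (deriv f₂) z = C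
  rw [hz]
  clear_value e
  have hI : Complex.I ^ 2 = -1 := Complex.I_sq
  generalize Complex.I = I at *
  have hI3 : I ^ 3 = -I := by rw [pow_succ, hI]; ring
  have hI4 : I ^ 4 = 1 := by rw [show I ^ 4 = (I ^ 2) ^ 2 by ring, hI]; ring
  field_simp
  ring_nf
  simp only [hI, hI3, hI4]
  ring
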